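/- arXiv:1903.06778 — 2 statements merged into one kernel-verified Lean document; each statement's English description precedes it below -/
import Mathlib

section
/- Let k and ℓ be positive integers, let n > max(2k, 2ℓ), and let x and z be positive real numbers with 0 < x + z < 1/k and x + z ≠ 2/n. Set y = (x+z)/2 and w = (1 − k(x+z))/(n−2k). Let A be the n×n matrix whose i-th row equals (x,…,x (k times), w,…,w (n−2k times), z,…,z (k times)) if 1 ≤ i ≤ ℓ, equals (y,…,y (k times), w,…,w (n−2k times), y,…,y (k times)) if ℓ+1 ≤ i ≤ n−ℓ, and equals (z,…,z (k times), w,…,w (n−2k times), x,…,x (k times)) if n−ℓ+1 ≤ i ≤ n. Then A is row stochastic but not column stochastic, and the matrix A·Y(A) obtained from A by one column scaling is doubly stochastic. -/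
open Matrix BigOperators

/-- The column scaling `A · Y(A)` of a square real matrix, where
`Y(A) = diag(1/colsum₁(A), …, 1/colsumₙ(A))`. -/
noncomputable def colScale {n : ℕ} (A : Matrix (Fin n) (Fin n) ℝ) : Matrix (Fin n) (Fin n) ℝ :=
  A * Matrix.diagonal (fun j => (∑ i, A i j)⁻¹)

/-- A square real matrix is row stochastic if it is nonnegative and all row sums equal 1. -/
def RowStochastic {n : ℕ} (A : Matrix (Fin n) (Fin n) ℝ) : Prop :=
  (∀ i j, 0 ≤ A i j) ∧ ∀ i, ∑ j, A i j = 1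

/-- A square real matrix is column stochastic if it is nonnegative and all column sums equal 1. -/
def ColStochastic {n : ℕ} (A : Matrix (Fin n) (Fin n) ℝ) : Prop :=
  (∀ i j, 0 ≤ A i j) ∧ ∀ j, ∑ i, A i j = 1

/-- The sum of a sequence constant on its first `k`, last `k` and remaining middle indices. -/
theorem sum_ite_outer_blocks {k n : ℕ} (h : 2 * k ≤ n) (a b c : ℝ) :
    ∑ j : Fin n, (if (j : ℕ) < k then a else if n - k ≤ (j : ℕ) then b else c) =
      k * a + k * b + ((n : ℝ) - 2 * k) * c := by
  obtain ⟨m, rfl⟩ : ∃ m, n = k + m + k := ⟨n - 2 * k, by omega⟩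
  simp only [Fin.sum_univ_add, Fin.val_castAdd, Fin.val_natAdd]
  have h_left (i : Fin k) : (if (i : ℕ) < k then a else
      if k + m + k - k ≤ (i : ℕ) then b else c) = a := if_pos i.isLt
  have h_mid (i : Fin m) : (if k + (i : ℕ) < k then a else
      if k + m + k - k ≤ k + (i : ℕ) then b else c) = c := by
    rw [if_neg (by omega), if_neg (by omega)]
  have h_right (i : Fin k) : (if k + m + (i : ℕ) < k then a else
      if k + m + k - k ≤ k + m + (i : ℕ) then b else c) = b := by
    rw [if_neg (by omega), if_pos (by omega)]
  simp only [h_left, h_mid, h_right, Finset.sum_const, Finset.card_univ, Fintype.card_fin,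
    nsmul_eq_mul]
  push_cast
  ring

theorem colScale_apply {n : ℕ} (A : Matrix (Fin n) (Fin n) ℝ) (i j : Fin n) :
    colScale A i j = A i j * (∑ i, A i j)⁻¹ :=
  Matrix.mul_diagonal _ _ _ _

/-- Column scaling makes a nonnegative matrix with nonzero column sums column stochastic. -/
theorem colStochastic_colScale {n : ℕ} {A : Matrix (Fin n) (Fin n) ℝ} (hA : ∀ i j, 0 ≤ A i j)
    (h : ∀ j, ∑ i, A i j ≠ 0) : ColStochastic (colScale A) := by
  refine ⟨fun i j => ?_, fun j => ?_⟩
  · rw [colScale_apply]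
    exact mul_nonneg (hA i j) (inv_nonneg.mpr (Finset.sum_nonneg fun i _ => hA i j))
  · simp only [colScale_apply, ← Finset.sum_mul]
    exact mul_inv_cancel₀ (h j)

theorem stmt_0 (k ℓ n : ℕ) (hk : 0 < k) (hℓ : 0 < ℓ) (hn : max (2 * k) (2 * ℓ) < n)
    (x z : ℝ) (hx : 0 < x) (hz : 0 < z) (hxz : x + z < 1 / (k : ℝ))
    (hne : x + z ≠ 2 / (n : ℝ))
    (y w : ℝ) (hy : y = (x + z) / 2)
    (hw : w = (1 - (k : ℝ) * (x + z)) / ((n : ℝ) - 2 * k))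
    (A : Matrix (Fin n) (Fin n) ℝ)
    (hA : ∀ i j : Fin n, A i j =
      if (j : ℕ) < k then
        (if (i : ℕ) < ℓ then x else if n - ℓ ≤ (i : ℕ) then z else y)
      else if n - k ≤ (j : ℕ) then
        (if (i : ℕ) < ℓ then z else if n - ℓ ≤ (i : ℕ) then x else y)
      else w) :
    RowStochastic A ∧ ¬ ColStochastic A ∧
      (RowStochastic (colScale A) ∧ ColStochastic (colScale A)) := by
  have h2k : 2 * k < n := (le_max_left _ _).trans_lt hn
  have h2ℓ : 2 * ℓ < n := (le_max_right _ _).trans_lt hn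
  have hn0 : (0 : ℝ) < n := by exact_mod_cast (by omega : 0 < n)
  have hk0 : (0 : ℝ) < k := by exact_mod_cast hk
  have hnk : (0 : ℝ) < (n : ℝ) - 2 * k := by
    have : (2 * k : ℝ) < n := by exact_mod_cast h2k
    linarith
  have hy0 : 0 < y := by linarith
  have hw0 : 0 < w := by
    rw [lt_div_iff₀ hk0] at hxz
    rw [hw]
    exact div_pos (by linarith) hnk
  have hkw : ((n : ℝ) - 2 * k) * w = 1 - k * (x + z) := by
    rw [hw]
    exact mul_div_cancel₀ _ hnk.ne'
  have h_nonneg : ∀ i j, 0 ≤ A i j := by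
    intro i j
    rw [hA]
    split_ifs <;> linarith
  have h_col (j : Fin n) : ∑ i, A i j =
      if (j : ℕ) < k then n * y else if n - k ≤ (j : ℕ) then n * y else n * w := by
    simp only [hA]
    split_ifs
    · rw [sum_ite_outer_blocks h2ℓ.le, hy]
      ring
    · rw [sum_ite_outer_blocks h2ℓ.le, hy]
      ring
    · simp
  have h_row : ∀ i, ∑ j, A i j = 1 := by
    intro i
    simp only [hA]
    rw [sum_ite_outer_blocks h2k.le, hkw]
    split_ifs <;> rw [← mul_add] <;> subst hy <;> ring
  have h_col_ne (j : Fin n) : ∑ i, A i j ≠ 0 := by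
    rw [h_col]
    split_ifs <;> positivity
  have h_scale := colStochastic_colScale h_nonneg h_col_ne
  refine ⟨⟨h_nonneg, h_row⟩, fun h => ?_, ⟨h_scale.1, fun i => ?_⟩, h_scale⟩
  · have h_first := h.2 ⟨0, by omega⟩
    rw [h_col, if_pos hk, hy] at h_first
    apply hne
    rw [eq_div_iff hn0.ne']
    linarith
  · have h_entry (j : Fin n) : colScale A i j =
        if (j : ℕ) < k then
          (if (i : ℕ) < ℓ then x else if n - ℓ ≤ (i : ℕ) then z else y) * (n * y)⁻¹
        else if n - k ≤ (j : ℕ) then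
          (if (i : ℕ) < ℓ then z else if n - ℓ ≤ (i : ℕ) then x else y) * (n * y)⁻¹
        else w * (n * w)⁻¹ := by
      rw [colScale_apply, h_col, hA]
      by_cases h_left : (j : ℕ) < k
      · simp only [if_pos h_left]
      · by_cases h_right : n - k ≤ (j : ℕ)
        · simp only [if_neg h_left, if_pos h_right]
        · simp only [if_neg h_left, if_neg h_right]
    have h_pair : (if (i : ℕ) < ℓ then x else if n - ℓ ≤ (i : ℕ) then z else y) +
        (if (i : ℕ) < ℓ then z else if n - ℓ ≤ (i : ℕ) then x else y) = 2 * y := by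
      split_ifs <;> linarith
    simp only [h_entry]
    rw [sum_ite_outer_blocks h2k.le, ← mul_add, ← add_mul, h_pair]
    field_simp
    ring
end

section
/- Let k and ℓ be positive integers, let n > max(2k, 2ℓ), and let x and z be positive real numbers with 0 < x + z < 1/k. Set y = (x+z)/2 and w = (1 − k(x+z))/(n−2k). Let A be the n×n matrix whose i-th row equals (x,…,x (k times), w,…,w (n−2k times), z,…,z (k times)) if 1 ≤ i ≤ ℓ, equals (y,…,y (k times), w,…,w (n−2k times), y,…,y (k times)) if ℓ+1 ≤ i ≤ n−ℓ, and equals (z,…,z (k times), w,…,w (n−2k times), x,…,x (k times)) if n−ℓ+1 ≤ i ≤ n. Then every row sum of the column-scaled matrix A·Y(A) equals 1, i.e., A·Y(A) is row stochastic. -/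
open Matrix BigOperators

theorem sum_fin_three_blocks (n m : ℕ) (h : 2 * m ≤ n) (a b c : ℝ) :
    ∑ i : Fin n, (if (i : ℕ) < m then a else if n - m ≤ (i : ℕ) then b else c) =
      m * a + m * b + ((n : ℝ) - 2 * m) * c := by
  obtain ⟨r, rfl⟩ : ∃ r, n = m + r + m := ⟨n - 2 * m, by omega⟩
  rw [Fin.sum_univ_eq_sum_range
    (fun i => if i < m then a else if m + r + m - m ≤ i then b else c),
    Finset.sum_range_add, Finset.sum_range_add]
  have h₁ : ∀ i ∈ Finset.range m,
      (if i < m then a else if m + r + m - m ≤ i then b else c) = a := by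
    intro i hi
    rw [if_pos (Finset.mem_range.mp hi)]
  have h₂ : ∀ i ∈ Finset.range r,
      (if m + i < m then a else if m + r + m - m ≤ m + i then b else c) = c := by
    intro i hi
    have := Finset.mem_range.mp hi
    rw [if_neg (by omega), if_neg (by omega)]
  have h₃ : ∀ i ∈ Finset.range m,
      (if m + r + i < m then a else if m + r + m - m ≤ m + r + i then b else c) = b := by
    intro i _
    rw [if_neg (by omega), if_pos (by omega)]
  rw [Finset.sum_congr rfl h₁, Finset.sum_congr rfl h₂, Finset.sum_congr rfl h₃]
  simp only [Finset.sum_const, Finset.card_range, nsmul_eq_mul]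
  push_cast
  ring

theorem stmt_4 (k ℓ n : ℕ) (hk : 0 < k) (hℓ : 0 < ℓ) (hn : max (2 * k) (2 * ℓ) < n)
    (x z : ℝ) (hx : 0 < x) (hz : 0 < z) (hxz : x + z < 1 / (k : ℝ))
    (y w : ℝ) (hy : y = (x + z) / 2)
    (hw : w = (1 - (k : ℝ) * (x + z)) / ((n : ℝ) - 2 * k))
    (A : Matrix (Fin n) (Fin n) ℝ)
    (hA : ∀ i j : Fin n, A i j =
      if (j : ℕ) < k then
        (if (i : ℕ) < ℓ then x else if n - ℓ ≤ (i : ℕ) then z else y)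
      else if n - k ≤ (j : ℕ) then
        (if (i : ℕ) < ℓ then z else if n - ℓ ≤ (i : ℕ) then x else y)
      else w) :
    ∀ i, ∑ j, colScale A i j = 1 := by
  have h2k : 2 * k < n := lt_of_le_of_lt (le_max_left _ _) hn
  have h2l : 2 * ℓ < n := lt_of_le_of_lt (le_max_right _ _) hn
  have hkR : (0 : ℝ) < k := by exact_mod_cast hk
  have hnk : (0 : ℝ) < (n : ℝ) - 2 * k := by
    have : (2 * k : ℝ) < n := by exact_mod_cast h2k
    linarith
  have hn0 : (n : ℝ) ≠ 0 := by
    have : n ≠ 0 := by omega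
    exact_mod_cast this
  have hw0 : w ≠ 0 := by
    rw [lt_div_iff₀ hkR] at hxz
    rw [hw]
    exact (div_pos (by linarith) hnk).ne'
  have hxz0 : x + z ≠ 0 := by positivity
  have hcol : ∀ j : Fin n, ∑ i, A i j =
      if (j : ℕ) < k then n * y else if n - k ≤ (j : ℕ) then n * y else n * w := by
    intro j
    simp only [hA]
    split_ifs with h₁ h₂
    · rw [sum_fin_three_blocks n ℓ h2l.le, hy]
      ring
    · rw [sum_fin_three_blocks n ℓ h2l.le, hy]
      ring
    · simp
  intro i
  have key : ∀ p q : ℝ, p + q = x + z →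
      (k : ℝ) * (p * (n * y)⁻¹) + k * (q * (n * y)⁻¹) +
        ((n : ℝ) - 2 * k) * (w * (n * w)⁻¹) = 1 := by
    intro p q hpq
    have hq : q = x + z - p := by linarith
    rw [hq, hy]
    field_simp
    ring
  obtain ⟨p, q, hpq, hrow⟩ : ∃ p q : ℝ, p + q = x + z ∧
      ∀ j : Fin n, A i j = if (j : ℕ) < k then p else if n - k ≤ (j : ℕ) then q else w := by
    simp only [hA]
    split_ifs
    · exact ⟨x, z, rfl, fun _ => rfl⟩
    · exact ⟨z, x, add_comm _ _, fun _ => rfl⟩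
    · exact ⟨y, y, by rw [hy]; ring, fun _ => rfl⟩
  rw [← key p q hpq, ← sum_fin_three_blocks n k h2k.le]
  refine Finset.sum_congr rfl fun j _ => ?_
  rw [colScale, Matrix.mul_diagonal, hcol, hrow]
  split_ifs <;> rfl
end
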